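/- Theorem 1.1(b). Let k = k(n) be a function with k(n) → ∞ and k(n)/n → 0 as n → ∞. Then asymptotically almost surely ξ(K_n, k) ~ 2 n ln k / k; that is, for every ε > 0 the probability that |ξ(K_n,k)·k/(2 n ln k) − 1| ≤ ε tends to 1 as n → ∞. -/

import Mathlib

open Finset Filter

/-- Positions: `p t a` is the vertex (an element of `Fin n`) occupied by agent `a` at the end of
round `t`. `greenSet n k p t` is the set of green agents at the end of round `t`; the initially
green agent is the agent with index `0`, and a white agent becomes green as soon as it occupies
the same vertex as a green agent. -/
def greenSet (n k : ℕ) (p : ℕ → Fin k → Fin n) : ℕ → Finset (Fin k)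
  | 0 => Finset.univ.filter fun a => ∃ b : Fin k, (b : ℕ) = 0 ∧ p 0 a = p 0 b
  | t + 1 =>
      greenSet n k p t ∪
        Finset.univ.filter fun a => ∃ b ∈ greenSet n k p t, p (t + 1) a = p (t + 1) b

/-- The probability that the `k` agents follow the trajectory prefix `p` during rounds
`0, 1, …, T`: each agent starts at a uniformly random vertex of `K_n` and then moves, each round
and independently of everything else, to a uniformly random vertex distinct from its current
one. -/
noncomputable def prefixProb (n k T : ℕ) (p : Fin (T + 1) → Fin k → Fin n) : ℝ :=
  ∏ a : Fin k, ((n : ℝ)⁻¹ *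
    ∏ t : Fin T, if p t.succ a = p t.castSucc a then 0 else ((n : ℝ) - 1)⁻¹)

/-- `probXiLe n k T` is `P(ξ(K_n, k) ≤ T)`: the probability that the broadcast is complete by
the end of round `T`. -/
noncomputable def probXiLe (n k T : ℕ) : ℝ :=
  ∑ p : Fin (T + 1) → Fin k → Fin n,
    if greenSet n k (fun t a => p ⟨min t T, Nat.lt_succ_of_le (min_le_right t T)⟩ a) T
        = Finset.univ
      then prefixProb n k T p else 0

/-- `probXiEq n k t` is `P(ξ(K_n, k) = t)`. -/
noncomputable def probXiEq (n k : ℕ) : ℕ → ℝ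
  | 0 => probXiLe n k 0
  | t + 1 => probXiLe n k (t + 1) - probXiLe n k t

/-- `probXiMem n k S` is `P(ξ(K_n, k) ∈ S)`: the probability that the broadcasting time of the
process with `k` agents on `K_n` belongs to the set `S ⊆ ℕ`. -/
noncomputable def probXiMem (n k : ℕ) (S : Set ℕ) : ℝ :=
  ∑' t, S.indicator (probXiEq n k) t

/-- `expXi n k = E[ξ(K_n, k)] = ∑_{t ≥ 0} P(ξ(K_n, k) > t)`. -/
noncomputable def expXi (n k : ℕ) : ℝ :=
  ∑' t, (1 - probXiLe n k t)



section ProductWeights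

variable {α V : Type*} [Fintype α] [DecidableEq α] [Fintype V]

/-- Expectation of `f` when the coordinates are independent with weights `p a`. -/
noncomputable def productExp (p : α → V → ℝ) (f : (α → V) → ℝ) : ℝ :=
  ∑ y : α → V, (∏ a, p a (y a)) * f y

lemma productExp_mono {p : α → V → ℝ} (hp : ∀ a v, 0 ≤ p a v) {f g : (α → V) → ℝ}
    (h : ∀ y, f y ≤ g y) : productExp p f ≤ productExp p g :=
  Finset.sum_le_sum fun y _ =>
    mul_le_mul_of_nonneg_left (h y) (Finset.prod_nonneg fun a _ => hp a _)

lemma productExp_add (p : α → V → ℝ) (f g : (α → V) → ℝ) :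
    productExp p (fun y => f y + g y) = productExp p f + productExp p g := by
  simp only [productExp, mul_add, Finset.sum_add_distrib]

lemma productExp_sub (p : α → V → ℝ) (f g : (α → V) → ℝ) :
    productExp p (fun y => f y - g y) = productExp p f - productExp p g := by
  simp only [productExp, mul_sub, Finset.sum_sub_distrib]

lemma productExp_const_mul (p : α → V → ℝ) (c : ℝ) (f : (α → V) → ℝ) :
    productExp p (fun y => c * f y) = c * productExp p f := by
  simp only [productExp, Finset.mul_sum]
  exact Finset.sum_congr rfl fun y _ => by ring

lemma productExp_sum {ι : Type*} (p : α → V → ℝ) (s : Finset ι) (f : ι → (α → V) → ℝ) :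
    productExp p (fun y => ∑ i ∈ s, f i y) = ∑ i ∈ s, productExp p (f i) := by
  simp only [productExp, Finset.mul_sum]
  exact Finset.sum_comm

lemma productExp_const {p : α → V → ℝ} (hp : ∀ a, ∑ v, p a v = 1) (c : ℝ) :
    productExp p (fun _ => c) = c := by
  classical
  simp only [productExp, ← Finset.sum_mul]
  rw [← Fintype.piFinset_univ, ← Finset.prod_univ_sum]
  simp [hp]

lemma productExp_resample {p : α → V → ℝ} (a : α) (ha : ∑ v, p a v = 1) (f : (α → V) → ℝ) :
    productExp p f = productExp p fun y => ∑ v, p a v * f (Function.update y a v) := by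
  have hinv : Function.Involutive
      (fun z : (α → V) × V => (Function.update z.1 a z.2, z.1 a)) := by
    intro z
    simp
  have hswap : ∀ z : (α → V) × V, (∏ b, p b (Function.update z.1 a z.2 b)) * p a (z.1 a)
      = (∏ b, p b (z.1 b)) * p a z.2 := by
    intro z
    rw [← Finset.mul_prod_erase _ _ (Finset.mem_univ a),
      ← Finset.mul_prod_erase _ (fun b => p b (z.1 b)) (Finset.mem_univ a)]
    have : ∏ b ∈ Finset.univ.erase a, p b (Function.update z.1 a z.2 b)
        = ∏ b ∈ Finset.univ.erase a, p b (z.1 b) :=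
      Finset.prod_congr rfl fun b hb => by
        rw [Function.update_of_ne (Finset.ne_of_mem_erase hb)]
    rw [this, Function.update_self]
    ring
  have h1 : productExp p f = ∑ z : (α → V) × V, (∏ b, p b (z.1 b)) * p a z.2 * f z.1 := by
    rw [Fintype.sum_prod_type]
    refine Finset.sum_congr rfl fun y _ => ?_
    dsimp only
    rw [← Finset.sum_mul, ← Finset.mul_sum, ha, mul_one]
  rw [h1, ← Equiv.sum_comp hinv.toPerm]
  simp only [Function.Involutive.coe_toPerm, hswap]
  rw [Fintype.sum_prod_type]
  refine Finset.sum_congr rfl fun y _ => ?_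
  rw [Finset.mul_sum]
  exact Finset.sum_congr rfl fun v _ => by ring

/-- If the factors `h a` for `a ∈ W` depend on the coordinates in `W` only through their last
argument, then the expectation of their product is bounded coordinate by coordinate. -/
lemma productExp_prod_le {p : α → V → ℝ} (hp0 : ∀ a v, 0 ≤ p a v) (hp : ∀ a, ∑ v, p a v = 1)
    (W : Finset α) (h : α → (α → V) → V → ℝ) {c : ℝ} (hc : 0 ≤ c)
    (hh : ∀ a y v, 0 ≤ h a y v)
    (hind : ∀ a ∈ W, ∀ b ∈ W, ∀ y v, h b (Function.update y a v) = h b y)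
    (hle : ∀ a ∈ W, ∀ y, ∑ v, p a v * h a y v ≤ c) :
    productExp p (fun y => ∏ a ∈ W, h a y (y a)) ≤ c ^ W.card := by
  induction W using Finset.induction_on with
  | empty => simp [productExp_const hp]
  | insert a W ha ih =>
    have ih' := ih (fun a ha b hb => hind a (Finset.mem_insert_of_mem ha) b
      (Finset.mem_insert_of_mem hb)) (fun a ha => hle a (Finset.mem_insert_of_mem ha))
    rw [productExp_resample a (hp a), Finset.card_insert_of_notMem ha, pow_succ']
    refine le_trans ?_ (mul_le_mul_of_nonneg_left ih' hc)
    rw [← productExp_const_mul]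
    refine productExp_mono hp0 fun y => ?_
    have : ∀ v, ∏ b ∈ insert a W, h b (Function.update y a v) (Function.update y a v b)
        = h a y v * ∏ b ∈ W, h b y (y b) := by
      intro v
      rw [Finset.prod_insert ha, Function.update_self,
        hind a (Finset.mem_insert_self _ _) a (Finset.mem_insert_self _ _)]
      congr 1
      refine Finset.prod_congr rfl fun b hb => ?_
      rw [hind a (Finset.mem_insert_self _ _) b (Finset.mem_insert_of_mem hb),
        Function.update_of_ne (ne_of_mem_of_not_mem hb ha)]
    simp only [this, ← mul_assoc, ← Finset.sum_mul]
    exact mul_le_mul_of_nonneg_right (hle a (Finset.mem_insert_self _ _) y)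
      (Finset.prod_nonneg fun b _ => hh b y _)

end ProductWeights

section Chain

variable {n k : ℕ}

/-- One-step transition probabilities of a single agent on `K_n`. -/
noncomputable def moveWeight (x : Fin k → Fin n) (a : Fin k) (v : Fin n) : ℝ :=
  if v = x a then 0 else ((n : ℝ) - 1)⁻¹

/-- The green agents after the agents have moved to the positions `y`. -/
def spread (G : Finset (Fin k)) (y : Fin k → Fin n) : Finset (Fin k) :=
  G ∪ Finset.univ.filter fun a => ∃ b ∈ G, y a = y b

/-- The green agents at the end of round `0`. -/
def seed (x : Fin k → Fin n) : Finset (Fin k) :=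
  Finset.univ.filter fun a => ∃ b : Fin k, (b : ℕ) = 0 ∧ x a = x b

/-- Transition operator of the Markov chain of green sets and positions. -/
noncomputable def stepExp (φ : Finset (Fin k) × (Fin k → Fin n) → ℝ)
    (s : Finset (Fin k) × (Fin k → Fin n)) : ℝ :=
  productExp (moveWeight s.2) fun y => φ (spread s.1 y, y)

/-- Expectation over the state at the end of round `0`. -/
noncomputable def initExp (φ : Finset (Fin k) × (Fin k → Fin n) → ℝ) : ℝ :=
  productExp (fun _ _ => (n : ℝ)⁻¹) fun x => φ (seed x, x)

lemma greenSet_congr {p q : ℕ → Fin k → Fin n} {T : ℕ} (h : ∀ t ≤ T, p t = q t) :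
    greenSet n k p T = greenSet n k q T := by
  induction T with
  | zero => simp [greenSet, h 0 le_rfl]
  | succ T ih =>
    simp only [greenSet, h (T + 1) le_rfl, ih fun t ht => h t (ht.trans (Nat.le_succ T))]

/-- Extension of a trajectory prefix to all rounds by its last value. -/
def extendPath {T : ℕ} (p : Fin (T + 1) → Fin k → Fin n) (t : ℕ) : Fin k → Fin n :=
  p ⟨min t T, Nat.lt_succ_of_le (min_le_right t T)⟩

lemma prefixProb_snoc {T : ℕ} (p : Fin (T + 1) → Fin k → Fin n) (y : Fin k → Fin n) :
    prefixProb n k (T + 1) (Fin.snoc (α := fun _ => Fin k → Fin n) p y)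
      = prefixProb n k T p * ∏ a, moveWeight (p (Fin.last T)) a (y a) := by
  simp only [prefixProb, ← Finset.prod_mul_distrib]
  refine Finset.prod_congr rfl fun a _ => ?_
  rw [Fin.prod_univ_castSucc, mul_assoc]
  congr 2
  · refine Finset.prod_congr rfl fun t _ => ?_
    rw [Fin.succ_castSucc, Fin.snoc_castSucc, Fin.snoc_castSucc]
  · rw [Fin.succ_last, Fin.snoc_last, Fin.snoc_castSucc]
    rfl

lemma greenSet_snoc {T : ℕ} (p : Fin (T + 1) → Fin k → Fin n) (y : Fin k → Fin n) :
    greenSet n k (extendPath (Fin.snoc (α := fun _ => Fin k → Fin n) p y)) (T + 1)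
      = spread (greenSet n k (extendPath p) T) y := by
  have h1 : extendPath (Fin.snoc (α := fun _ => Fin k → Fin n) p y) (T + 1) = y := by
    have : (⟨min (T + 1) (T + 1), Nat.lt_succ_of_le (min_le_right _ _)⟩ : Fin (T + 2))
        = Fin.last (T + 1) := by ext; simp
    simp only [extendPath, this, Fin.snoc_last]
  have h2 : greenSet n k (extendPath (Fin.snoc (α := fun _ => Fin k → Fin n) p y)) T
      = greenSet n k (extendPath p) T := by
    refine greenSet_congr fun t ht => ?_
    have : (⟨min t (T + 1), Nat.lt_succ_of_le (min_le_right _ _)⟩ : Fin (T + 2))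
        = Fin.castSucc ⟨min t T, Nat.lt_succ_of_le (min_le_right t T)⟩ := by
      ext; simp; omega
    simp only [extendPath, this, Fin.snoc_castSucc]
  simp only [greenSet, spread, h1, h2]

lemma sum_prefixProb_mul (T : ℕ) (φ : Finset (Fin k) × (Fin k → Fin n) → ℝ) :
    ∑ p : Fin (T + 1) → Fin k → Fin n,
        prefixProb n k T p * φ (greenSet n k (extendPath p) T, p (Fin.last T))
      = initExp (stepExp^[T] φ) := by
  induction T generalizing φ with
  | zero =>
    rw [← Equiv.sum_comp (Equiv.funUnique (Fin 1) (Fin k → Fin n)).symm]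
    refine Finset.sum_congr rfl fun x _ => ?_
    simp [prefixProb, greenSet, seed, extendPath]
  | succ T ih =>
    rw [Function.iterate_succ_apply, ← ih,
      ← Equiv.sum_comp (Fin.snocEquiv fun _ : Fin (T + 1 + 1) => (Fin k → Fin n)),
      Fintype.sum_prod_type, Finset.sum_comm]
    refine Finset.sum_congr rfl fun p _ => ?_
    rw [stepExp, productExp, Finset.mul_sum]
    refine Finset.sum_congr rfl fun y _ => ?_
    have : (Fin.snocEquiv fun _ : Fin (T + 1 + 1) => (Fin k → Fin n)) (y, p)
        = Fin.snoc (α := fun _ => Fin k → Fin n) p y := rfl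
    simp only [this]
    rw [prefixProb_snoc, greenSet_snoc, Fin.snoc_last, mul_assoc]

lemma probXiLe_eq_initExp (T : ℕ) :
    probXiLe n k T = initExp (n := n) (stepExp^[T] fun s : Finset (Fin k) × (Fin k → Fin n) =>
      if s.1 = Finset.univ then 1 else 0) := by
  rw [← sum_prefixProb_mul, probXiLe]
  refine Finset.sum_congr rfl fun p _ => ?_
  simp only [mul_ite, mul_one, mul_zero]
  rfl

end Chain

section OneStep

variable {n k : ℕ}

lemma inv_sub_one_nonneg (hn : 2 ≤ n) : 0 ≤ ((n : ℝ) - 1)⁻¹ := by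
  have : (2 : ℝ) ≤ n := by exact_mod_cast hn
  exact inv_nonneg.2 (by linarith)

lemma moveWeight_nonneg (hn : 2 ≤ n) (x : Fin k → Fin n) (a : Fin k) (v : Fin n) :
    0 ≤ moveWeight x a v := by
  unfold moveWeight
  split_ifs
  exacts [le_rfl, inv_sub_one_nonneg hn]

lemma moveWeight_le (hn : 2 ≤ n) (x : Fin k → Fin n) (a : Fin k) (v : Fin n) :
    moveWeight x a v ≤ ((n : ℝ) - 1)⁻¹ := by
  unfold moveWeight
  split_ifs
  exacts [inv_sub_one_nonneg hn, le_rfl]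

lemma sum_moveWeight (hn : 2 ≤ n) (x : Fin k → Fin n) (a : Fin k) :
    ∑ v, moveWeight x a v = 1 := by
  have h2 : (2 : ℝ) ≤ n := by exact_mod_cast hn
  simp only [moveWeight]
  rw [Finset.sum_ite, Finset.sum_const_zero, zero_add, Finset.sum_const,
    Finset.filter_ne' Finset.univ (x a), Finset.card_erase_of_mem (Finset.mem_univ _),
    Finset.card_univ, Fintype.card_fin, nsmul_eq_mul, Nat.cast_sub (by omega), Nat.cast_one,
    mul_inv_cancel₀ (by linarith)]

/-- Indicator of the event that the vertex `v` is occupied by an agent of `G`. -/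
noncomputable def hit (G : Finset (Fin k)) (y : Fin k → Fin n) (v : Fin n) : ℝ :=
  if v ∈ G.image y then 1 else 0

lemma hit_nonneg (G : Finset (Fin k)) (y : Fin k → Fin n) (v : Fin n) : 0 ≤ hit G y v := by
  unfold hit
  split_ifs <;> norm_num

lemma hit_update {G : Finset (Fin k)} {a : Fin k} (ha : a ∉ G) (y : Fin k → Fin n) (v : Fin n) :
    hit G (Function.update y a v) = hit G y := by
  have : G.image (Function.update y a v) = G.image y :=
    Finset.image_congr fun b hb => Function.update_of_ne (ne_of_mem_of_not_mem hb ha) _ _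
  unfold hit
  rw [this]

lemma sum_moveWeight_mul_hit_le (hn : 2 ≤ n) (x : Fin k → Fin n) (a : Fin k)
    (G : Finset (Fin k)) (y : Fin k → Fin n) :
    ∑ v, moveWeight x a v * hit G y v ≤ G.card * ((n : ℝ) - 1)⁻¹ := by
  calc ∑ v, moveWeight x a v * hit G y v ≤ ∑ v, ((n : ℝ) - 1)⁻¹ * hit G y v :=
        Finset.sum_le_sum fun v _ =>
          mul_le_mul_of_nonneg_right (moveWeight_le hn x a v) (hit_nonneg G y v)
    _ = (G.image y).card * ((n : ℝ) - 1)⁻¹ := by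
        rw [← Finset.mul_sum, mul_comm]
        simp only [hit]
        rw [Finset.sum_ite_mem, Finset.univ_inter, Finset.sum_const, nsmul_one]
    _ ≤ _ := by
        have := inv_sub_one_nonneg hn
        gcongr
        exact Finset.card_image_le

lemma productExp_hit_le (hn : 2 ≤ n) (x : Fin k → Fin n) {G : Finset (Fin k)} {a : Fin k}
    (ha : a ∉ G) :
    productExp (moveWeight x) (fun y => hit G y (y a)) ≤ G.card * ((n : ℝ) - 1)⁻¹ := by
  have h := productExp_prod_le (moveWeight_nonneg hn x) (sum_moveWeight hn x) {a}
    (fun _ y v => hit G y v) (mul_nonneg (Nat.cast_nonneg G.card) (inv_sub_one_nonneg hn))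
    (fun _ y v => hit_nonneg G y v)
    (fun b hb _ _ y v => by
      rw [Finset.mem_singleton] at hb
      subst hb
      rw [hit_update ha])
    (fun b _ y => sum_moveWeight_mul_hit_le hn x b G y)
  simpa using h

lemma productExp_hit_mul_hit_le (hn : 2 ≤ n) (x : Fin k → Fin n) {G : Finset (Fin k)}
    {a a' : Fin k} (ha : a ∉ G) (ha' : a' ∉ G) (hne : a ≠ a') :
    productExp (moveWeight x) (fun y => hit G y (y a) * hit G y (y a'))
      ≤ (G.card * ((n : ℝ) - 1)⁻¹) ^ 2 := by
  have h := productExp_prod_le (moveWeight_nonneg hn x) (sum_moveWeight hn x) {a, a'}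
    (fun _ y v => hit G y v) (mul_nonneg (Nat.cast_nonneg G.card) (inv_sub_one_nonneg hn))
    (fun _ y v => hit_nonneg G y v)
    (fun b hb _ _ y v => by
      have hb : b ∉ G := by
        rcases Finset.mem_insert.1 hb with rfl | hb
        · exact ha
        · rwa [Finset.mem_singleton.1 hb]
      rw [hit_update hb])
    (fun b _ y => sum_moveWeight_mul_hit_le hn x b G y)
  simpa [Finset.prod_pair hne, Finset.card_pair hne] using h

lemma productExp_meet_ge (hn : 2 ≤ n) (x : Fin k → Fin n) {a b : Fin k} (hab : a ≠ b) :
    ((n : ℝ) - 1)⁻¹ * (1 - ((n : ℝ) - 1)⁻¹)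
      ≤ productExp (moveWeight x) (fun y => if y b = y a then (1 : ℝ) else 0) := by
  have h1 : productExp (moveWeight x) (fun y => if y a = x b then (1 : ℝ) else 0)
      ≤ ((n : ℝ) - 1)⁻¹ := by
    have h := productExp_prod_le (moveWeight_nonneg hn x) (sum_moveWeight hn x) {a}
      (fun _ _ v => if v = x b then (1 : ℝ) else 0) (inv_sub_one_nonneg hn)
      (fun _ _ v => by split_ifs <;> norm_num) (fun _ _ _ _ _ _ => rfl)
      (fun c _ y => by simpa using moveWeight_le hn x c (x b))
    simpa using h
  rw [productExp_resample b (sum_moveWeight hn x b)]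
  have h2 : ∀ y : Fin k → Fin n, ∑ v, moveWeight x b v *
      (if Function.update y b v b = Function.update y b v a then (1 : ℝ) else 0)
      = ((n : ℝ) - 1)⁻¹ - ((n : ℝ) - 1)⁻¹ * if y a = x b then (1 : ℝ) else 0 := by
    intro y
    simp only [Function.update_self, Function.update_of_ne hab]
    simp only [mul_ite, mul_one, mul_zero, Finset.sum_ite_eq', Finset.mem_univ, if_true, moveWeight]
    split_ifs <;> simp
  simp only [h2]
  rw [productExp_sub, productExp_const_mul, productExp_const (sum_moveWeight hn x)]
  have := mul_le_mul_of_nonneg_left h1 (inv_sub_one_nonneg hn)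
  linarith

lemma productExp_meet_mul_meet_le (hn : 2 ≤ n) (x : Fin k → Fin n) {a b b' : Fin k}
    (hab : a ≠ b) (hab' : a ≠ b') (hne : b ≠ b') :
    productExp (moveWeight x) (fun y => (if y b = y a then (1 : ℝ) else 0) *
      if y b' = y a then (1 : ℝ) else 0) ≤ ((n : ℝ) - 1)⁻¹ ^ 2 := by
  have h := productExp_prod_le (moveWeight_nonneg hn x) (sum_moveWeight hn x) {b, b'}
    (fun _ y v => if v = y a then (1 : ℝ) else 0) (inv_sub_one_nonneg hn)
    (fun _ _ v => by split_ifs <;> norm_num)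
    (fun c hc _ _ y v => by
      have : a ≠ c := by
        rcases Finset.mem_insert.1 hc with rfl | hc
        · exact hab
        · rwa [Finset.mem_singleton.1 hc]
      simp only [Function.update_of_ne this])
    (fun c _ y => by simpa using moveWeight_le hn x c (y a))
  simpa only [Finset.prod_pair hne, Finset.card_pair hne] using h

lemma sum_mul_sum_erase {ι : Type*} [DecidableEq ι] (s : Finset ι) (f : ι → ℝ)
    (hf : ∀ i ∈ s, f i * f i = f i) :
    ∑ i ∈ s, ∑ j ∈ s.erase i, f i * f j = (∑ i ∈ s, f i) ^ 2 - ∑ i ∈ s, f i := by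
  rw [sq, Finset.sum_mul, ← Finset.sum_sub_distrib]
  refine Finset.sum_congr rfl fun i hi => ?_
  rw [← Finset.mul_sum, ← Finset.add_sum_erase s f hi, mul_add, hf i hi]
  ring

lemma sum_sum_erase_le {ι : Type*} [DecidableEq ι] (s : Finset ι) (f : ι → ι → ℝ) {c : ℝ}
    (h : ∀ i ∈ s, ∀ j ∈ s, i ≠ j → f i j ≤ c) :
    ∑ i ∈ s, ∑ j ∈ s.erase i, f i j ≤ s.card * (s.card - 1) * c := by
  have : ∀ i ∈ s, ∑ j ∈ s.erase i, f i j ≤ (s.card - 1) * c := by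
    intro i hi
    have h1 := Finset.sum_le_card_nsmul (s.erase i) (f i) c fun j hj =>
      h i hi j (Finset.mem_of_mem_erase hj) (Finset.ne_of_mem_erase hj).symm
    rwa [nsmul_eq_mul, Finset.card_erase_of_mem hi,
      Nat.cast_sub (Finset.card_pos.2 ⟨i, hi⟩), Nat.cast_one] at h1
  have h2 := Finset.sum_le_card_nsmul s _ _ this
  rwa [nsmul_eq_mul, ← mul_assoc] at h2

lemma productExp_hit_ge (hn : 2 ≤ n) (x : Fin k → Fin n) {G : Finset (Fin k)} {a : Fin k}
    (ha : a ∉ G) :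
    G.card * ((n : ℝ) - 1)⁻¹ * (1 - G.card * ((n : ℝ) - 1)⁻¹)
      ≤ productExp (moveWeight x) (fun y => hit G y (y a)) := by
  set r := ((n : ℝ) - 1)⁻¹
  let e : Fin k → (Fin k → Fin n) → ℝ := fun b y => if y b = y a then (1 : ℝ) else 0
  have hpt : ∀ y, ∑ b ∈ G, e b y - ∑ b ∈ G, ∑ b' ∈ G.erase b, e b y * e b' y
      ≤ hit G y (y a) := by
    intro y
    rw [sum_mul_sum_erase G (fun b => e b y) fun b _ => by simp only [e]; split_ifs <;> norm_num]
    by_cases hy : y a ∈ G.image y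
    · simp only [hit, if_pos hy]
      nlinarith [sq_nonneg (∑ b ∈ G, e b y - 1)]
    · have : ∑ b ∈ G, e b y = 0 := Finset.sum_eq_zero fun b hb =>
        if_neg fun h : y b = y a => hy (h ▸ Finset.mem_image_of_mem y hb)
      rw [this]
      simpa using hit_nonneg G y (y a)
  refine le_trans ?_ (productExp_mono (moveWeight_nonneg hn x) hpt)
  rw [productExp_sub, productExp_sum, productExp_sum]
  simp only [productExp_sum]
  have hne : ∀ b ∈ G, a ≠ b := fun b hb => (ne_of_mem_of_not_mem hb ha).symm
  have h1 := Finset.card_nsmul_le_sum G (fun b => productExp (moveWeight x) (e b)) _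
    fun b hb => productExp_meet_ge hn x (hne b hb)
  have h2 := sum_sum_erase_le G
    (fun b b' => productExp (moveWeight x) (fun y => e b y * e b' y))
    fun b hb b' hb' h => productExp_meet_mul_meet_le hn x (hne b hb) (hne b' hb') h
  rw [nsmul_eq_mul] at h1
  have : (G.card : ℝ) * r * (1 - G.card * r)
      = G.card * (r * (1 - r)) - G.card * (G.card - 1) * r ^ 2 := by ring
  rw [this]
  exact sub_le_sub h1 h2

lemma card_spread (G : Finset (Fin k)) (y : Fin k → Fin n) :
    ((spread G y).card : ℝ) = G.card + ∑ a ∈ Gᶜ, hit G y (y a) := by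
  have h1 : spread G y = G ∪ Gᶜ.filter fun a => y a ∈ G.image y := by
    ext a
    simp only [spread, Finset.mem_union, Finset.mem_filter, Finset.mem_univ, true_and,
      Finset.mem_compl, Finset.mem_image]
    constructor
    · rintro (h | ⟨b, hb, h⟩)
      · exact Or.inl h
      · by_cases ha : a ∈ G
        · exact Or.inl ha
        · exact Or.inr ⟨ha, b, hb, h.symm⟩
    · rintro (h | ⟨_, b, hb, h⟩)
      · exact Or.inl h
      · exact Or.inr ⟨b, hb, h.symm⟩
  rw [h1, Finset.card_union_of_disjoint, Nat.cast_add]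
  · simp [hit]
  · exact Finset.disjoint_left.2 fun a ha h =>
      Finset.mem_compl.1 (Finset.mem_filter.1 h).1 ha

lemma card_compl_cast (G : Finset (Fin k)) : ((Gᶜ.card : ℕ) : ℝ) = k - G.card := by
  rw [Finset.card_compl, Fintype.card_fin, Nat.cast_sub]
  simpa using Finset.card_le_univ G

lemma card_le_cast (G : Finset (Fin k)) : (G.card : ℝ) ≤ k := by
  exact_mod_cast (by simpa using Finset.card_le_univ G : G.card ≤ k)

/-- The mean number of green agents grows by a factor at most `1 + k / (n - 1)` per round. -/
lemma productExp_card_spread_le (hn : 2 ≤ n) (G : Finset (Fin k)) (x : Fin k → Fin n) :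
    productExp (moveWeight x) (fun y => ((spread G y).card : ℝ))
      ≤ (1 + k * ((n : ℝ) - 1)⁻¹) * G.card := by
  simp only [card_spread]
  rw [productExp_add, productExp_const (sum_moveWeight hn x), productExp_sum]
  have h := Finset.sum_le_card_nsmul Gᶜ
    (fun a => productExp (moveWeight x) (fun y => hit G y (y a))) _
    fun a ha => productExp_hit_le hn x (Finset.mem_compl.1 ha)
  rw [nsmul_eq_mul, card_compl_cast] at h
  have := inv_sub_one_nonneg hn
  have : 0 ≤ (G.card : ℝ) * (G.card * ((n : ℝ) - 1)⁻¹) := by positivity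
  linarith

/-- White agents survive a round at least as well as independent agents with conversion
probability `k / (n - 1)` each. -/
lemma productExp_pow_card_compl_spread_le (hn : 2 ≤ n) (G : Finset (Fin k)) (x : Fin k → Fin n)
    {s : ℝ} (hs0 : 0 ≤ s) (hs1 : s ≤ 1) :
    productExp (moveWeight x) (fun y => s ^ (spread G y)ᶜ.card)
      ≤ (1 - (1 - k * ((n : ℝ) - 1)⁻¹) * (1 - s)) ^ Gᶜ.card := by
  have hr := inv_sub_one_nonneg hn
  have hpt : ∀ y : Fin k → Fin n, s ^ (spread G y)ᶜ.card
      = ∏ a ∈ Gᶜ, (s + (1 - s) * hit G y (y a)) := by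
    intro y
    have h1 : (spread G y)ᶜ = Gᶜ.filter fun a => y a ∉ G.image y := by
      ext a
      simp only [spread, Finset.mem_compl, Finset.mem_union, Finset.mem_filter, Finset.mem_univ,
        true_and, Finset.mem_image, not_or, not_exists, not_and]
      exact and_congr_right fun _ => forall₂_congr fun b _ => ⟨Ne.symm, Ne.symm⟩
    have h2 : ∀ a, s + (1 - s) * hit G y (y a) = if y a ∉ G.image y then s else 1 := by
      intro a
      unfold hit
      by_cases h : y a ∈ G.image y
      · rw [if_pos h, if_neg (not_not.2 h)]; ring
      · rw [if_neg h, if_pos h]; ring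
    simp only [h2]
    rw [Finset.prod_ite, Finset.prod_const, Finset.prod_const_one, mul_one, h1]
  simp only [hpt]
  have hk : 0 ≤ (k : ℝ) * ((n : ℝ) - 1)⁻¹ := by positivity
  refine productExp_prod_le (moveWeight_nonneg hn x) (sum_moveWeight hn x) Gᶜ
    (fun _ y v => s + (1 - s) * hit G y v) (by nlinarith) (fun _ y v => ?_)
    (fun a ha b _ y v => ?_) (fun a _ y => ?_)
  · have := hit_nonneg G y v
    have : 0 ≤ 1 - s := by linarith
    positivity
  · simp only [hit_update (Finset.mem_compl.1 ha)]
  · have h1 : ∑ v, moveWeight x a v * (s + (1 - s) * hit G y v)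
        = s + (1 - s) * ∑ v, moveWeight x a v * hit G y v := by
      simp only [mul_add, Finset.sum_add_distrib, ← Finset.sum_mul, sum_moveWeight hn, one_mul,
        Finset.mul_sum]
      congr 1
      exact Finset.sum_congr rfl fun v _ => by ring
    rw [h1]
    have h2 := sum_moveWeight_mul_hit_le hn x a G y
    have h3 : (G.card : ℝ) * ((n : ℝ) - 1)⁻¹ ≤ k * ((n : ℝ) - 1)⁻¹ :=
      mul_le_mul_of_nonneg_right (card_le_cast G) hr
    have h4 := mul_le_mul_of_nonneg_left (h2.trans h3) (by linarith : 0 ≤ 1 - s)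
    linarith

lemma div_add_sub_one_le {κ g : ℝ} (hκ : 0 ≤ κ) (hg : 0 < g) (m : ℕ) :
    κ / (g + m) - 1 ≤ κ / g - 1 - κ / (g * (g + 1)) * (m - ((m : ℝ) ^ 2 - m) / (g + 1)) := by
  rcases Nat.eq_zero_or_pos m with rfl | hm
  · simp
  have hm' : (1 : ℝ) ≤ m := by exact_mod_cast hm
  have h : κ / g - 1 - κ / (g * (g + 1)) * (m - ((m : ℝ) ^ 2 - m) / (g + 1))
      - (κ / (g + m) - 1) = κ * m * (m - 1) ^ 2 / (g * (g + 1) ^ 2 * (g + m)) := by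
    field_simp
    ring
  have : 0 ≤ κ * m * (m - 1) ^ 2 / (g * (g + 1) ^ 2 * (g + m)) := by positivity
  linarith

/-- The ratio of white to green agents contracts on average. -/
lemma productExp_white_green_ratio_le (hn : 2 ≤ n) {G : Finset (Fin k)} (hG : G.Nonempty)
    (x : Fin k → Fin n) :
    productExp (moveWeight x) (fun y => (k : ℝ) / (spread G y).card - 1)
      ≤ (1 - k * ((n : ℝ) - 1)⁻¹ * (1 - 2 * (k * ((n : ℝ) - 1)⁻¹)) * (G.card / (G.card + 1)))
        * (k / G.card - 1) := by
  have hr := inv_sub_one_nonneg hn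
  set r := ((n : ℝ) - 1)⁻¹
  set g : ℝ := (G.card : ℝ)
  have hg : 0 < g := Nat.cast_pos.2 (Finset.card_pos.2 hG)
  have hgk : g ≤ k := card_le_cast G
  let X : (Fin k → Fin n) → ℝ := fun y => ∑ a ∈ Gᶜ, hit G y (y a)
  let Y : (Fin k → Fin n) → ℝ := fun y => ∑ a ∈ Gᶜ, ∑ b ∈ Gᶜ.erase a, hit G y (y a) * hit G y (y b)
  have hpt : ∀ y, (k : ℝ) / (spread G y).card - 1
      ≤ (fun _ => (k : ℝ) / g - 1) y - k / (g * (g + 1)) * (X y - (1 / (g + 1)) * Y y) := by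
    intro y
    have hY : Y y = X y ^ 2 - X y := sum_mul_sum_erase _ _ fun a _ => by
      unfold hit; split_ifs <;> norm_num
    have hX : X y = ((Gᶜ.filter fun a => y a ∈ G.image y).card : ℕ) := by simp [X, hit]
    rw [card_spread, hY]
    change (k : ℝ) / (g + X y) - 1 ≤ _
    rw [hX]
    refine (div_add_sub_one_le (Nat.cast_nonneg k) hg _).trans_eq ?_
    ring
  refine (productExp_mono (moveWeight_nonneg hn x) hpt).trans ?_
  rw [productExp_sub, productExp_const (sum_moveWeight hn x), productExp_const_mul,
    productExp_sub, productExp_const_mul]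
  have hX : (k - g) * (g * r * (1 - g * r)) ≤ productExp (moveWeight x) X := by
    have h := Finset.card_nsmul_le_sum Gᶜ
      (fun a => productExp (moveWeight x) (fun y => hit G y (y a))) _
      fun a ha => productExp_hit_ge hn x (Finset.mem_compl.1 ha)
    rw [nsmul_eq_mul, card_compl_cast] at h
    rwa [productExp_sum]
  have hY : productExp (moveWeight x) Y ≤ (k - g) * (k - g - 1) * (g * r) ^ 2 := by
    have h := sum_sum_erase_le Gᶜ
      (fun a b => productExp (moveWeight x) (fun y => hit G y (y a) * hit G y (y b)))
      fun a ha b hb h => productExp_hit_mul_hit_le hn x (Finset.mem_compl.1 ha)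
        (Finset.mem_compl.1 hb) h
    rw [card_compl_cast] at h
    rw [productExp_sum]
    simpa only [productExp_sum] using h
  have hmain : (k - g) * (g * r) * (1 - 2 * (k * r))
      ≤ productExp (moveWeight x) X - 1 / (g + 1) * productExp (moveWeight x) Y := by
    have h1 : 1 / (g + 1) * productExp (moveWeight x) Y ≤ (k - g) * (g * r) * (k * r) := by
      rw [one_div, inv_mul_le_iff₀ (by positivity)]
      refine hY.trans ?_
      have h2 : (k - g - 1) * g ≤ (g + 1) * k := by nlinarith
      have h3 : 0 ≤ (k - g) * (g * r) * r := by
        have : 0 ≤ k - g := by linarith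
        positivity
      nlinarith [mul_le_mul_of_nonneg_left h2 h3]
    have h4 : (k - g) * (g * r) * (g * r) ≤ (k - g) * (g * r) * (k * r) := by
      have : 0 ≤ k - g := by linarith
      gcongr
    linarith
  have hfac : 0 ≤ (k : ℝ) / (g * (g + 1)) := by positivity
  refine (sub_le_sub_left (mul_le_mul_of_nonneg_left hmain hfac) _).trans_eq ?_
  field_simp

end OneStep

section ManySteps

variable {n k : ℕ}

lemma subset_spread (G : Finset (Fin k)) (y : Fin k → Fin n) : G ⊆ spread G y :=
  Finset.subset_union_left

lemma stepExp_mono (hn : 2 ≤ n) {φ ψ : Finset (Fin k) × (Fin k → Fin n) → ℝ}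
    (h : ∀ s, s.1.Nonempty → φ s ≤ ψ s) {s : Finset (Fin k) × (Fin k → Fin n)}
    (hs : s.1.Nonempty) : stepExp φ s ≤ stepExp ψ s :=
  productExp_mono (moveWeight_nonneg hn s.2) fun y => h _ (hs.mono (subset_spread s.1 y))

lemma stepExp_const (hn : 2 ≤ n) (c : ℝ) (s : Finset (Fin k) × (Fin k → Fin n)) :
    stepExp (fun _ => c) s = c :=
  productExp_const (sum_moveWeight hn s.2) c

lemma stepExp_iterate_mono (hn : 2 ≤ n) {φ ψ : Finset (Fin k) × (Fin k → Fin n) → ℝ}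
    (h : ∀ s, s.1.Nonempty → φ s ≤ ψ s) (T : ℕ) {s : Finset (Fin k) × (Fin k → Fin n)}
    (hs : s.1.Nonempty) : (stepExp^[T] φ) s ≤ (stepExp^[T] ψ) s := by
  induction T generalizing s with
  | zero => exact h s hs
  | succ T ih =>
    rw [Function.iterate_succ_apply', Function.iterate_succ_apply']
    exact stepExp_mono hn (fun s hs => ih hs) hs

lemma stepExp_iterate_const (hn : 2 ≤ n) (c : ℝ) (T : ℕ) :
    stepExp^[T] (fun _ : Finset (Fin k) × (Fin k → Fin n) => c) = fun _ => c :=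
  Function.iterate_fixed (funext fun s => stepExp_const hn c s) T

lemma stepExp_iterate_one_sub (hn : 2 ≤ n) (φ : Finset (Fin k) × (Fin k → Fin n) → ℝ) (T : ℕ) :
    stepExp^[T] (fun s => 1 - φ s) = fun s => 1 - (stepExp^[T] φ) s := by
  induction T with
  | zero => rfl
  | succ T ih =>
    rw [Function.iterate_succ_apply', ih]
    funext s
    have h := productExp_sub (moveWeight s.2) (fun _ => 1)
      fun y => (stepExp^[T] φ) (spread s.1 y, y)
    rw [productExp_const (sum_moveWeight hn s.2)] at h
    rw [Function.iterate_succ_apply']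
    exact h

lemma stepExp_iterate_affine_le (hn : 2 ≤ n) {φ : Finset (Fin k) × (Fin k → Fin n) → ℝ} {c : ℝ}
    (hc : 0 ≤ c) (h : ∀ s, s.1.Nonempty → stepExp φ s ≤ c * φ s) {A : ℝ} (hA : 0 ≤ A) (C : ℝ)
    (T : ℕ) {s : Finset (Fin k) × (Fin k → Fin n)} (hs : s.1.Nonempty) :
    (stepExp^[T] fun s => A * φ s + C) s ≤ A * c ^ T * φ s + C := by
  induction T generalizing s with
  | zero => simp
  | succ T ih =>
    rw [Function.iterate_succ_apply']
    refine (stepExp_mono hn (fun s hs => ih hs) hs).trans ?_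
    have : stepExp (fun s => A * c ^ T * φ s + C) s = A * c ^ T * stepExp φ s + C := by
      unfold stepExp
      rw [productExp_add, productExp_const (sum_moveWeight hn s.2), productExp_const_mul]
    rw [this, pow_succ]
    have := mul_le_mul_of_nonneg_left (h s hs) (by positivity : 0 ≤ A * c ^ T)
    linarith

lemma sum_uniform (hn : 0 < n) : ∑ _v : Fin n, (n : ℝ)⁻¹ = 1 := by
  have : (n : ℝ) ≠ 0 := by exact_mod_cast hn.ne'
  simp [this]

lemma seed_nonempty (hk : 0 < k) (x : Fin k → Fin n) : (seed x).Nonempty :=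
  ⟨⟨0, hk⟩, by simp only [seed, Finset.mem_filter, Finset.mem_univ, true_and]
               exact ⟨⟨0, hk⟩, rfl, rfl⟩⟩

lemma initExp_mono (hk : 0 < k) {φ ψ : Finset (Fin k) × (Fin k → Fin n) → ℝ}
    (h : ∀ s, s.1.Nonempty → φ s ≤ ψ s) : initExp φ ≤ initExp ψ :=
  productExp_mono (fun _ _ => by positivity) fun x => h _ (seed_nonempty hk x)

lemma initExp_const (hn : 0 < n) (c : ℝ) :
    initExp (fun _ : Finset (Fin k) × (Fin k → Fin n) => c) = c :=
  productExp_const (fun _ => sum_uniform hn) c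

lemma initExp_card_le (hn : 2 ≤ n) (hk : 0 < k) :
    initExp (fun s : Finset (Fin k) × (Fin k → Fin n) => (s.1.card : ℝ))
      ≤ 1 + k * ((n : ℝ) - 1)⁻¹ := by
  let z : Fin k := ⟨0, hk⟩
  have hn0 : 0 < n := by omega
  have h2 : (2 : ℝ) ≤ n := by exact_mod_cast hn
  have hpt : ∀ x : Fin k → Fin n, ((seed x).card : ℝ)
      = 1 + ∑ a ∈ Finset.univ.erase z, if x a = x z then (1 : ℝ) else 0 := by
    intro x
    have h1 : seed x = Finset.univ.filter fun a => x a = x z := by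
      ext a
      simp only [seed, Finset.mem_filter, Finset.mem_univ, true_and]
      constructor
      · rintro ⟨b, hb, h⟩
        rwa [show z = b from Fin.ext hb.symm]
      · exact fun h => ⟨z, rfl, h⟩
    have h3 : ((seed x).card : ℝ) = ∑ a, if x a = x z then (1 : ℝ) else 0 := by
      rw [h1, Finset.sum_boole]
    rw [h3, ← Finset.add_sum_erase _ _ (Finset.mem_univ z), if_pos rfl]
  unfold initExp
  simp only [hpt]
  rw [productExp_add, productExp_const (fun _ => sum_uniform hn0), productExp_sum]
  have h := Finset.sum_le_card_nsmul (Finset.univ.erase z)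
    (fun a => productExp (fun _ _ => (n : ℝ)⁻¹)
      fun x : Fin k → Fin n => if x a = x z then (1 : ℝ) else 0) (n : ℝ)⁻¹ fun a ha => by
    have h := productExp_prod_le (p := fun (_ : Fin k) (_ : Fin n) => (n : ℝ)⁻¹)
      (fun _ _ => by positivity) (fun _ => sum_uniform hn0) {a}
      (fun _ y v => if v = y z then (1 : ℝ) else 0) (c := (n : ℝ)⁻¹) (by positivity)
      (fun _ y v => by split_ifs <;> norm_num)
      (fun b hb _ _ y v => by
        have : z ≠ b := by
          rw [Finset.mem_singleton.1 hb]
          exact (Finset.ne_of_mem_erase ha).symm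
        simp only [Function.update_of_ne this])
      (fun _ _ y => by simp)
    simpa using h
  have hcard : ((Finset.univ.erase z).card : ℝ) ≤ k := by
    exact_mod_cast (Finset.card_le_univ _).trans_eq (Fintype.card_fin k)
  have hinv : (n : ℝ)⁻¹ ≤ ((n : ℝ) - 1)⁻¹ := inv_anti₀ (by linarith) (by linarith)
  rw [nsmul_eq_mul] at h
  have h5 : ((Finset.univ.erase z).card : ℝ) * (n : ℝ)⁻¹ ≤ k * ((n : ℝ) - 1)⁻¹ :=
    mul_le_mul hcard hinv (by positivity) (by positivity)
  linarith

lemma probXiLe_nonneg (hn : 2 ≤ n) (hk : 0 < k) (T : ℕ) : 0 ≤ probXiLe n k T := by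
  rw [probXiLe_eq_initExp]
  refine (initExp_const (n := n) (k := k) (by omega) 0).symm.trans_le
    (initExp_mono hk fun s hs => ?_)
  refine (congrFun (stepExp_iterate_const hn 0 T) s).symm.trans_le
    (stepExp_iterate_mono hn (fun s _ => ?_) T hs)
  split_ifs <;> norm_num

lemma probXiLe_le_one (hn : 2 ≤ n) (hk : 0 < k) (T : ℕ) : probXiLe n k T ≤ 1 := by
  rw [probXiLe_eq_initExp]
  refine (initExp_mono hk fun s hs => ?_).trans_eq
    (initExp_const (n := n) (k := k) (by omega) 1)
  refine (stepExp_iterate_mono hn (fun s _ => ?_) T hs).trans_eq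
    (congrFun (stepExp_iterate_const hn 1 T) s)
  split_ifs <;> norm_num

lemma probXiLe_mono (hn : 2 ≤ n) (hk : 0 < k) : Monotone (probXiLe n k) := by
  refine monotone_nat_of_le_succ fun T => ?_
  rw [probXiLe_eq_initExp, probXiLe_eq_initExp]
  refine initExp_mono hk fun s hs => ?_
  rw [Function.iterate_succ_apply]
  refine stepExp_iterate_mono hn (fun s _ => ?_) T hs
  by_cases h : s.1 = Finset.univ
  · have : ∀ y : Fin k → Fin n, spread s.1 y = Finset.univ := fun y =>
      Finset.univ_subset_iff.1 (h ▸ subset_spread s.1 y)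
    simp only [h, stepExp]
    rw [h] at this
    simp only [this]
    exact (productExp_const (sum_moveWeight hn s.2) _).ge
  · rw [if_neg h]
    refine (stepExp_const hn 0 s).symm.trans_le
      (productExp_mono (moveWeight_nonneg hn s.2) fun y => ?_)
    dsimp only
    split_ifs <;> norm_num

lemma stepExp_iterate_all_green_le (hn : 2 ≤ n) (hk : k * ((n : ℝ) - 1)⁻¹ ≤ 1) (T : ℕ)
    {s : Finset (Fin k) × (Fin k → Fin n)} (hs : s.1.Nonempty) :
    (stepExp^[T] fun s : Finset (Fin k) × (Fin k → Fin n) =>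
      if s.1 = Finset.univ then (1 : ℝ) else 0) s
      ≤ (1 - (1 - k * ((n : ℝ) - 1)⁻¹) ^ T) ^ s.1ᶜ.card := by
  have hr := inv_sub_one_nonneg hn
  have hk0 : 0 ≤ k * ((n : ℝ) - 1)⁻¹ := by positivity
  induction T generalizing s with
  | zero =>
    by_cases h : s.1 = Finset.univ
    · simp [h]
    · have : s.1ᶜ.card ≠ 0 := by simpa using h
      simp [h]
  | succ T ih =>
    rw [Function.iterate_succ_apply']
    refine (stepExp_mono hn (fun s hs => ih hs) hs).trans ?_
    refine (productExp_pow_card_compl_spread_le hn s.1 s.2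
      (sub_nonneg.2 (pow_le_one₀ (sub_nonneg.2 hk) (by linarith)))
      (sub_le_self _ (pow_nonneg (sub_nonneg.2 hk) T))).trans_eq ?_
    rw [pow_succ]
    ring_nf

/-- Upper bound for the probability of an early completion. -/
lemma probXiLe_add_le (hn : 2 ≤ n) (hk : 0 < k) (hkn : k * ((n : ℝ) - 1)⁻¹ ≤ 1) (T₁ T₂ : ℕ) :
    probXiLe n k (T₁ + T₂) ≤ 2 / k * (1 + k * ((n : ℝ) - 1)⁻¹) ^ (T₁ + 1)
      + Real.exp (-((1 - k * ((n : ℝ) - 1)⁻¹) ^ T₂ * (k / 2))) := by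
  have hr := inv_sub_one_nonneg hn
  have hk' : (0 : ℝ) < k := by exact_mod_cast hk
  have hk0 : 0 ≤ k * ((n : ℝ) - 1)⁻¹ := by positivity
  set q := (1 - k * ((n : ℝ) - 1)⁻¹) ^ T₂
  have hq0 : 0 ≤ q := pow_nonneg (sub_nonneg.2 hkn) _
  have hq1 : q ≤ 1 := pow_le_one₀ (sub_nonneg.2 hkn) (by linarith)
  have hpt : ∀ s : Finset (Fin k) × (Fin k → Fin n), s.1.Nonempty →
      (stepExp^[T₂] fun s : Finset (Fin k) × (Fin k → Fin n) =>
        if s.1 = Finset.univ then (1 : ℝ) else 0) s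
        ≤ 2 / k * (s.1.card : ℝ) + Real.exp (-(q * (k / 2))) := by
    intro s hs
    refine (stepExp_iterate_all_green_le hn hkn T₂ hs).trans ?_
    by_cases h : (k : ℝ) / 2 ≤ s.1.card
    · have h1 : (1 - q) ^ s.1ᶜ.card ≤ 1 := pow_le_one₀ (by linarith) (by linarith)
      have h2 : 1 ≤ 2 / (k : ℝ) * s.1.card := by
        rw [div_mul_eq_mul_div, le_div_iff₀ hk']
        linarith
      have := Real.exp_pos (-(q * (k / 2)))
      exact h1.trans (by linarith)
    · have h1 : (1 - q) ^ s.1ᶜ.card ≤ Real.exp (-q) ^ s.1ᶜ.card :=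
        pow_le_pow_left₀ (by linarith) (Real.one_sub_le_exp_neg q) _
      have h2 : (k : ℝ) / 2 ≤ (s.1ᶜ.card : ℕ) := by
        rw [card_compl_cast]
        linarith
      have h3 : Real.exp (-q) ^ s.1ᶜ.card ≤ Real.exp (-(q * (k / 2))) := by
        rw [← Real.exp_nat_mul]
        refine Real.exp_le_exp.2 ?_
        have := mul_le_mul_of_nonneg_left h2 hq0
        linarith
      have : 0 ≤ 2 / (k : ℝ) * s.1.card := by positivity
      exact h1.trans (h3.trans (by linarith))
  rw [probXiLe_eq_initExp]
  have hstep : ∀ s : Finset (Fin k) × (Fin k → Fin n), s.1.Nonempty →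
      (stepExp^[T₁ + T₂] fun s : Finset (Fin k) × (Fin k → Fin n) =>
        if s.1 = Finset.univ then (1 : ℝ) else 0) s
        ≤ 2 / k * (1 + k * ((n : ℝ) - 1)⁻¹) ^ T₁ * (s.1.card : ℝ)
          + Real.exp (-(q * (k / 2))) := by
    intro s hs
    rw [Function.iterate_add_apply]
    exact (stepExp_iterate_mono hn hpt T₁ hs).trans
      (stepExp_iterate_affine_le hn (by positivity)
        (fun s _ => productExp_card_spread_le hn s.1 s.2) (by positivity) _ T₁ hs)
  refine (initExp_mono hk hstep).trans ?_
  have : initExp (fun s : Finset (Fin k) × (Fin k → Fin n) =>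
      2 / k * (1 + k * ((n : ℝ) - 1)⁻¹) ^ T₁ * (s.1.card : ℝ) + Real.exp (-(q * (k / 2))))
      = 2 / k * (1 + k * ((n : ℝ) - 1)⁻¹) ^ T₁ *
        initExp (fun s : Finset (Fin k) × (Fin k → Fin n) => (s.1.card : ℝ))
        + Real.exp (-(q * (k / 2))) := by
    unfold initExp
    rw [productExp_add, productExp_const (fun _ => sum_uniform (by omega)), productExp_const_mul]
  rw [this, pow_succ, ← mul_assoc]
  gcongr
  exact initExp_card_le hn hk

/-- The ratio of white to green agents. -/
noncomputable def whiteGreenRatio (s : Finset (Fin k) × (Fin k → Fin n)) : ℝ :=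
  (k : ℝ) / s.1.card - 1

lemma whiteGreenRatio_nonneg {s : Finset (Fin k) × (Fin k → Fin n)} (hs : s.1.Nonempty) :
    0 ≤ whiteGreenRatio s := by
  have h : (0 : ℝ) < s.1.card := by exact_mod_cast Finset.card_pos.2 hs
  rw [whiteGreenRatio, sub_nonneg, le_div_iff₀ h, one_mul]
  exact card_le_cast s.1

lemma whiteGreenRatio_le {s : Finset (Fin k) × (Fin k → Fin n)} (hs : s.1.Nonempty) :
    whiteGreenRatio s ≤ k := by
  have h : (1 : ℝ) ≤ s.1.card := by exact_mod_cast Finset.card_pos.2 hs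
  have : (k : ℝ) / s.1.card ≤ k := div_le_self (Nat.cast_nonneg k) h
  unfold whiteGreenRatio
  linarith

lemma stepExp_whiteGreenRatio_le (hn : 2 ≤ n) (hkn : k * ((n : ℝ) - 1)⁻¹ ≤ 1 / 2) {L : ℕ}
    {s : Finset (Fin k) × (Fin k → Fin n)} (hs : s.1.Nonempty) (hL : L ≤ s.1.card) :
    stepExp whiteGreenRatio s
      ≤ (1 - k * ((n : ℝ) - 1)⁻¹ * (1 - 2 * (k * ((n : ℝ) - 1)⁻¹)) * (L / (L + 1)))
        * whiteGreenRatio s := by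
  have hr := inv_sub_one_nonneg hn
  refine (productExp_white_green_ratio_le hn hs s.2).trans
    (mul_le_mul_of_nonneg_right ?_ (whiteGreenRatio_nonneg hs))
  have h1 : (L : ℝ) / (L + 1) ≤ s.1.card / (s.1.card + 1) := by
    have : (L : ℝ) ≤ s.1.card := by exact_mod_cast hL
    rw [div_le_div_iff₀ (by positivity) (by positivity)]
    linarith
  have h2 : 0 ≤ k * ((n : ℝ) - 1)⁻¹ * (1 - 2 * (k * ((n : ℝ) - 1)⁻¹)) :=
    mul_nonneg (by positivity) (by linarith)
  have := mul_le_mul_of_nonneg_left h1 h2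
  linarith

lemma contraction_nonneg (hn : 2 ≤ n) (hkn : k * ((n : ℝ) - 1)⁻¹ ≤ 1 / 2) (L : ℕ) :
    0 ≤ 1 - k * ((n : ℝ) - 1)⁻¹ * (1 - 2 * (k * ((n : ℝ) - 1)⁻¹)) * ((L : ℝ) / (L + 1)) := by
  have hr := inv_sub_one_nonneg hn
  have hk0 : 0 ≤ k * ((n : ℝ) - 1)⁻¹ := by positivity
  have h1 : (L : ℝ) / (L + 1) ≤ 1 := (div_le_one (by positivity)).2 (by linarith)
  have h2 : k * ((n : ℝ) - 1)⁻¹ * (1 - 2 * (k * ((n : ℝ) - 1)⁻¹)) ≤ 1 := by nlinarith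
  have := mul_le_one₀ h2 (by positivity) h1
  linarith

lemma stepExp_iterate_not_all_green_le (hn : 2 ≤ n) (hkn : k * ((n : ℝ) - 1)⁻¹ ≤ 1 / 2) (L T : ℕ)
    {s : Finset (Fin k) × (Fin k → Fin n)} (hs : s.1.Nonempty) :
    (stepExp^[T] fun s : Finset (Fin k) × (Fin k → Fin n) =>
      1 - if s.1 = Finset.univ then (1 : ℝ) else 0) s
      ≤ k * (1 - k * ((n : ℝ) - 1)⁻¹ * (1 - 2 * (k * ((n : ℝ) - 1)⁻¹)) * (L / (L + 1))) ^ T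
          * whiteGreenRatio s + if s.1.card < L then 1 else 0 := by
  have hc := contraction_nonneg hn hkn L
  set c := 1 - k * ((n : ℝ) - 1)⁻¹ * (1 - 2 * (k * ((n : ℝ) - 1)⁻¹)) * ((L : ℝ) / (L + 1))
  by_cases hL : s.1.card < L
  · rw [if_pos hL]
    have h1 := (stepExp_iterate_mono hn (ψ := fun _ => 1)
      (φ := fun s : Finset (Fin k) × (Fin k → Fin n) =>
        1 - if s.1 = Finset.univ then (1 : ℝ) else 0)
      (fun s _ => by split_ifs <;> norm_num) T hs).trans_eq
      (congrFun (stepExp_iterate_const hn 1 T) s)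
    have h2 : 0 ≤ k * c ^ T * whiteGreenRatio s := by
      have := whiteGreenRatio_nonneg hs
      positivity
    exact h1.trans (by linarith)
  · induction T generalizing s with
    | zero =>
      rw [if_neg hL]
      simp only [Function.iterate_zero, id_eq, pow_zero, mul_one, add_zero]
      by_cases h : s.1 = Finset.univ
      · rw [if_pos h, sub_self]
        exact mul_nonneg (Nat.cast_nonneg k) (whiteGreenRatio_nonneg hs)
      · rw [if_neg h, sub_zero, whiteGreenRatio]
        have h0 : (0 : ℝ) < s.1.card := by exact_mod_cast Finset.card_pos.2 hs
        have h1 : (s.1.card : ℝ) + 1 ≤ k := by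
          have : s.1.card < Fintype.card (Fin k) := (Finset.card_lt_iff_ne_univ s.1).2 h
          rw [Fintype.card_fin] at this
          exact_mod_cast this
        rw [div_sub_one h0.ne', mul_div_assoc', le_div_iff₀ h0]
        nlinarith
    | succ T ih =>
      rw [Function.iterate_succ_apply']
      have hsp : ∀ y : Fin k → Fin n, ¬ (spread s.1 y).card < L := fun y h =>
        hL ((Finset.card_le_card (subset_spread s.1 y)).trans_lt h)
      have h1 : stepExp (stepExp^[T] fun s : Finset (Fin k) × (Fin k → Fin n) =>
          1 - if s.1 = Finset.univ then (1 : ℝ) else 0) s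
          ≤ productExp (moveWeight s.2)
            fun y => k * c ^ T * whiteGreenRatio (spread s.1 y, y) := by
        refine productExp_mono (moveWeight_nonneg hn s.2) fun y => ?_
        refine (ih (s := (spread s.1 y, y)) (hs.mono (subset_spread s.1 y)) (hsp y)).trans_eq ?_
        rw [if_neg (hsp y), add_zero]
      refine h1.trans ?_
      rw [productExp_const_mul, if_neg hL, add_zero, pow_succ, ← mul_assoc, mul_assoc _ c]
      exact mul_le_mul_of_nonneg_left
        (stepExp_whiteGreenRatio_le hn hkn hs (not_lt.1 hL)) (by positivity)

/-- Upper bound for the probability of a late completion. -/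
lemma one_sub_probXiLe_add_le (hn : 2 ≤ n) (hkn : k * ((n : ℝ) - 1)⁻¹ ≤ 1 / 2) {L : ℕ}
    (hL : 0 < L) (hLk : L < k) (T₁ T₂ : ℕ) :
    1 - probXiLe n k (T₁ + T₂) ≤
      (k * (1 - k * ((n : ℝ) - 1)⁻¹ * (1 - 2 * (k * ((n : ℝ) - 1)⁻¹)) * (L / (L + 1))) ^ T₂
          + ((k : ℝ) / L - 1)⁻¹)
        * (1 - k * ((n : ℝ) - 1)⁻¹ * (1 - 2 * (k * ((n : ℝ) - 1)⁻¹)) * (1 / 2)) ^ T₁ * k := by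
  have hc := contraction_nonneg hn hkn L
  have hd : 0 ≤ 1 - k * ((n : ℝ) - 1)⁻¹ * (1 - 2 * (k * ((n : ℝ) - 1)⁻¹)) * (1 / 2) := by
    simpa [one_add_one_eq_two] using contraction_nonneg hn hkn 1
  set c := 1 - k * ((n : ℝ) - 1)⁻¹ * (1 - 2 * (k * ((n : ℝ) - 1)⁻¹)) * ((L : ℝ) / (L + 1))
  set d := 1 - k * ((n : ℝ) - 1)⁻¹ * (1 - 2 * (k * ((n : ℝ) - 1)⁻¹)) * (1 / 2)
  have hL' : (0 : ℝ) < L := by exact_mod_cast hL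
  have hLk' : (0 : ℝ) < (k : ℝ) / L - 1 := by
    rw [sub_pos, lt_div_iff₀ hL', one_mul]
    exact_mod_cast hLk
  set B := k * c ^ T₂ + ((k : ℝ) / L - 1)⁻¹
  have hB : 0 ≤ B := by positivity
  have hpt : ∀ s : Finset (Fin k) × (Fin k → Fin n), s.1.Nonempty →
      (stepExp^[T₂] fun s : Finset (Fin k) × (Fin k → Fin n) =>
        1 - if s.1 = Finset.univ then (1 : ℝ) else 0) s ≤ B * whiteGreenRatio s + 0 := by
    intro s hs
    refine (stepExp_iterate_not_all_green_le hn hkn L T₂ hs).trans ?_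
    have h1 : (if s.1.card < L then (1 : ℝ) else 0) ≤ ((k : ℝ) / L - 1)⁻¹ * whiteGreenRatio s := by
      split_ifs with h
      · refine (inv_mul_cancel₀ hLk'.ne').symm.trans_le ?_
        refine mul_le_mul_of_nonneg_left (sub_le_sub_right ?_ 1) (inv_nonneg.2 hLk'.le)
        have h0 : (0 : ℝ) < s.1.card := by exact_mod_cast Finset.card_pos.2 hs
        have : (s.1.card : ℝ) ≤ L := by exact_mod_cast h.le
        gcongr
      · exact mul_nonneg (inv_nonneg.2 hLk'.le) (whiteGreenRatio_nonneg hs)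
    rw [add_zero, add_mul]
    exact add_le_add_right h1 _
  have hstep : ∀ s : Finset (Fin k) × (Fin k → Fin n), s.1.Nonempty →
      1 - (stepExp^[T₁ + T₂] fun s : Finset (Fin k) × (Fin k → Fin n) =>
        if s.1 = Finset.univ then (1 : ℝ) else 0) s ≤ B * d ^ T₁ * k := by
    intro s hs
    have h1 := congrFun (stepExp_iterate_one_sub hn (fun s : Finset (Fin k) × (Fin k → Fin n) =>
        if s.1 = Finset.univ then (1 : ℝ) else 0) (T₁ + T₂)) s
    rw [← h1, Function.iterate_add_apply]
    have h2 := (stepExp_iterate_mono hn hpt T₁ hs).trans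
      (stepExp_iterate_affine_le hn hd (fun s hs => by
        simpa [one_add_one_eq_two, d] using
          stepExp_whiteGreenRatio_le (L := 1) hn hkn hs (Finset.card_pos.2 hs)) hB 0 T₁ hs)
    rw [add_zero] at h2
    exact h2.trans (mul_le_mul_of_nonneg_left (whiteGreenRatio_le hs) (by positivity))
  have hfin := initExp_mono (hL.trans hLk) hstep
  rw [initExp_const (by omega)] at hfin
  refine le_trans (le_of_eq ?_) hfin
  rw [probXiLe_eq_initExp]
  unfold initExp
  rw [productExp_sub, productExp_const fun _ => sum_uniform (by omega)]

end ManySteps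

section Asymptotics

variable {n k : ℕ}

lemma sum_range_succ_probXiEq (m : ℕ) :
    ∑ t ∈ Finset.range (m + 1), probXiEq n k t = probXiLe n k m := by
  induction m with
  | zero => simp [probXiEq]
  | succ m ih =>
    rw [Finset.sum_range_succ, ih, probXiEq]
    ring

lemma probXiMem_eq_sum {N ε : ℝ} (hN : 0 < N) (hε : 0 < ε) :
    probXiMem n k {t : ℕ | |(t : ℝ) / N - 1| ≤ ε}
      = ∑ t ∈ Finset.Ico ⌈N * (1 - ε)⌉₊ (⌊N * (1 + ε)⌋₊ + 1), probXiEq n k t := by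
  have hmem : ∀ t : ℕ, t ∈ {t : ℕ | |(t : ℝ) / N - 1| ≤ ε}
      ↔ t ∈ Finset.Ico ⌈N * (1 - ε)⌉₊ (⌊N * (1 + ε)⌋₊ + 1) := by
    intro t
    rw [Set.mem_ofPred_eq, Finset.mem_Ico, Nat.lt_succ_iff, Nat.ceil_le,
      Nat.le_floor_iff (by positivity), abs_le, neg_le_sub_iff_le_add, sub_le_iff_le_add,
      div_le_iff₀ hN, ← sub_le_iff_le_add, le_div_iff₀ hN, mul_comm N, mul_comm N, add_comm 1 ε]
  rw [probXiMem, tsum_eq_sum (s := Finset.Ico ⌈N * (1 - ε)⌉₊ (⌊N * (1 + ε)⌋₊ + 1))]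
  · exact Finset.sum_congr rfl fun t ht => Set.indicator_of_mem ((hmem t).2 ht) _
  · exact fun t ht => Set.indicator_of_notMem (fun h => ht ((hmem t).1 h)) _

lemma probXiMem_bounds (hn : 2 ≤ n) (hk : 0 < k) {N ε δ : ℝ} (hN : 0 < N) (hδ : 0 < δ)
    (hδε : δ ≤ ε) :
    probXiLe n k ⌊N * (1 + δ)⌋₊ - probXiLe n k ⌊N * (1 - δ)⌋₊
        ≤ probXiMem n k {t : ℕ | |(t : ℝ) / N - 1| ≤ ε} ∧
      probXiMem n k {t : ℕ | |(t : ℝ) / N - 1| ≤ ε} ≤ 1 := by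
  have hε := hδ.trans_le hδε
  have hle : ⌈N * (1 - ε)⌉₊ ≤ ⌊N * (1 + ε)⌋₊ + 1 := by
    refine (Nat.ceil_mono ?_).trans (Nat.ceil_le_floor_add_one _)
    nlinarith
  rw [probXiMem_eq_sum hN hε, Finset.sum_Ico_eq_sub _ hle, sum_range_succ_probXiEq]
  have hB : probXiLe n k ⌊N * (1 + δ)⌋₊ ≤ probXiLe n k ⌊N * (1 + ε)⌋₊ :=
    probXiLe_mono hn hk (Nat.floor_mono (by nlinarith))
  have hB1 := probXiLe_le_one hn hk ⌊N * (1 + ε)⌋₊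
  have hA0 := probXiLe_nonneg hn hk ⌊N * (1 - δ)⌋₊
  rcases hA : ⌈N * (1 - ε)⌉₊ with _ | a
  · rw [Finset.sum_range_zero]
    constructor <;> linarith
  · rw [sum_range_succ_probXiEq]
    have ha : (a : ℝ) < N * (1 - ε) := Nat.lt_ceil.1 (by omega)
    have h1 : probXiLe n k a ≤ probXiLe n k ⌊N * (1 - δ)⌋₊ :=
      probXiLe_mono hn hk (Nat.le_floor (by nlinarith))
    have h2 := probXiLe_nonneg hn hk a
    constructor <;> linarith

/-- Relation between the expected length of the process and the single-round meeting rate. -/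
lemma rate_mul_length (hn : 2 ≤ n) (hk : 0 < k) :
    k * ((n : ℝ) - 1)⁻¹ * (2 * n * Real.log k / k)
      = 2 * Real.log k * (1 + ((n : ℝ) - 1)⁻¹) := by
  have h2 : (2 : ℝ) ≤ n := by exact_mod_cast hn
  have h1 : (n : ℝ) - 1 ≠ 0 := by linarith
  have hk' : (k : ℝ) ≠ 0 := by exact_mod_cast hk.ne'
  field_simp
  ring

lemma exp_neg_le_one_sub_pow {ρ : ℝ} (h : ρ ≤ 1 / 2) (T : ℕ) :
    Real.exp (-((1 + 2 * ρ) * (ρ * T))) ≤ (1 - ρ) ^ T := by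
  have h1 : Real.exp (-((1 + 2 * ρ) * ρ)) ≤ 1 - ρ := by
    rw [Real.exp_neg]
    have h2 := Real.add_one_le_exp ((1 + 2 * ρ) * ρ)
    refine inv_le_of_inv_le₀ (by linarith) (le_trans ?_ h2)
    rw [inv_le_iff_one_le_mul₀ (by linarith)]
    nlinarith [mul_nonneg (sq_nonneg ρ) (by linarith : 0 ≤ 1 - 2 * ρ)]
  calc Real.exp (-((1 + 2 * ρ) * (ρ * T))) = Real.exp (-((1 + 2 * ρ) * ρ)) ^ T := by
        rw [← Real.exp_nat_mul]
        ring_nf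
    _ ≤ _ := pow_le_pow_left₀ (Real.exp_pos _).le h1 T

lemma one_sub_pow_le_exp {x : ℝ} (h : x ≤ 1) (T : ℕ) : (1 - x) ^ T ≤ Real.exp (-(x * T)) := by
  calc (1 - x) ^ T ≤ Real.exp (-x) ^ T :=
        pow_le_pow_left₀ (by linarith) (Real.one_sub_le_exp_neg x) T
    _ = _ := by
        rw [← Real.exp_nat_mul]
        ring_nf

lemma probXiLe_early_le (hn : 2 ≤ n) (hk : 0 < k) {δ : ℝ} (hδ : 0 < δ) (hδ1 : δ ≤ 1)
    (hρδ : k * ((n : ℝ) - 1)⁻¹ ≤ δ / 16) :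
    probXiLe n k ⌊2 * n * Real.log k / k * (1 - δ)⌋₊
      ≤ 2 * Real.exp (1 - δ / 4 * Real.log k)
        + Real.exp (-(Real.exp (δ / 4 * Real.log k - 1) / 2)) := by
  have hk1 : (1 : ℝ) ≤ k := by exact_mod_cast hk
  have hr := inv_sub_one_nonneg hn
  have hl : 0 ≤ Real.log k := Real.log_nonneg hk1
  have hlen := rate_mul_length hn hk
  have hrρ : ((n : ℝ) - 1)⁻¹ ≤ k * ((n : ℝ) - 1)⁻¹ := le_mul_of_one_le_left hr hk1
  have hN : 0 ≤ 2 * n * Real.log k / k := by positivity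
  have hF := Nat.floor_le (mul_nonneg hN (by linarith : 0 ≤ 1 - δ))
  set N := 2 * n * Real.log k / k
  set T := ⌊N * (1 - δ)⌋₊
  have hmain := probXiLe_add_le hn hk (by linarith) (T / 2) (T - T / 2)
  rw [Nat.add_sub_of_le (Nat.div_le_self T 2)] at hmain
  have hT1 : ((T / 2 : ℕ) : ℝ) * 2 ≤ T := by exact_mod_cast Nat.div_mul_le_self T 2
  have hT2 : ((T - T / 2 : ℕ) : ℝ) * 2 ≤ T + 1 := by exact_mod_cast (by omega)
  set T₁ := T / 2
  set T₂ := T - T / 2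
  set r := ((n : ℝ) - 1)⁻¹
  set ρ := k * r
  set l := Real.log k
  have hρ : 0 ≤ ρ := by positivity
  have hρT : ρ * T ≤ 2 * (l * (1 - δ) * (1 + ρ)) := by
    have h1 := mul_le_mul_of_nonneg_left hF hρ
    have h2 : 0 ≤ l * (1 - δ) := mul_nonneg hl (by linarith)
    have h3 := mul_le_mul_of_nonneg_left hrρ h2
    nlinarith
  have hρT1 : ρ * T₁ ≤ l * (1 - δ) * (1 + ρ) := by
    have := mul_le_mul_of_nonneg_left hT1 hρ
    linarith
  have hρT2 : ρ * T₂ ≤ l * (1 - δ) * (1 + ρ) + ρ := by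
    have := mul_le_mul_of_nonneg_left hT2 hρ
    linarith
  have hexpl : Real.exp l = k := Real.exp_log (by linarith)
  refine hmain.trans (add_le_add ?_ (Real.exp_le_exp.2 (neg_le_neg ?_)))
  · have h1 : (1 + ρ) ^ (T₁ + 1) ≤ Real.exp (l * (1 - δ / 4) + 1) := by
      calc (1 + ρ) ^ (T₁ + 1) ≤ Real.exp ρ ^ (T₁ + 1) :=
            pow_le_pow_left₀ (by linarith) (by linarith [Real.add_one_le_exp ρ]) _
        _ = Real.exp (ρ * T₁ + ρ) := by
            rw [← Real.exp_nat_mul]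
            push_cast
            ring_nf
        _ ≤ _ := by
            refine Real.exp_le_exp.2 ?_
            have : (1 - δ) * (1 + ρ) ≤ 1 - δ / 4 := by nlinarith
            have := mul_le_mul_of_nonneg_left this hl
            linarith
    calc 2 / (k : ℝ) * (1 + ρ) ^ (T₁ + 1) ≤ 2 / k * Real.exp (l * (1 - δ / 4) + 1) := by
          gcongr
      _ = 2 * Real.exp (1 - δ / 4 * l) := by
          rw [← hexpl, div_mul_eq_mul_div, mul_div_assoc, ← Real.exp_sub]
          ring_nf
  · have h1 : Real.exp (-(l * (1 - δ / 4) + 1)) ≤ (1 - ρ) ^ T₂ := by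
      refine le_trans (Real.exp_le_exp.2 (neg_le_neg ?_))
        (exp_neg_le_one_sub_pow (by linarith) T₂)
      have h2 := mul_le_mul_of_nonneg_left hρT2 (by linarith : 0 ≤ 1 + 2 * ρ)
      have h3 : (1 + 2 * ρ) * ((1 - δ) * (1 + ρ)) ≤ 1 - δ / 4 := by
        have : (1 + 2 * ρ) * (1 + ρ) ≤ 1 + δ / 2 := by nlinarith
        have := mul_le_mul_of_nonneg_right this (by linarith : 0 ≤ 1 - δ)
        nlinarith
      have h4 := mul_le_mul_of_nonneg_left h3 hl
      have h5 : (1 + 2 * ρ) * ρ ≤ 1 := by nlinarith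
      nlinarith
    calc Real.exp (δ / 4 * l - 1) / 2 = Real.exp (-(l * (1 - δ / 4) + 1)) * (k / 2) := by
          rw [← hexpl, mul_div_assoc', ← Real.exp_add]
          ring_nf
      _ ≤ _ := by gcongr

lemma contraction_pow_le_exp {l δ ρ θ : ℝ} {T : ℕ} (hl : 0 ≤ l) (hδ : 0 < δ) (hδ1 : δ ≤ 1)
    (hρ : 0 ≤ ρ) (hρδ : ρ ≤ δ / 16) (hθ : 1 - δ / 8 ≤ θ) (hθ1 : θ ≤ 1)
    (hT : l * (2 + δ) - ρ ≤ ρ * T) :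
    (1 - ρ * (1 - 2 * ρ) * θ) ^ T ≤ Real.exp (1 - l * (2 + δ / 4)) := by
  have hθρ : (1 - δ / 8) * (1 - δ / 8) ≤ (1 - 2 * ρ) * θ :=
    mul_le_mul (by linarith) hθ (by linarith) (by linarith)
  have hθρ1 : (1 - 2 * ρ) * θ ≤ 1 := mul_le_one₀ (by linarith) (by linarith) hθ1
  have hθρ0 : 0 ≤ (1 - 2 * ρ) * θ := mul_nonneg (by linarith) (by linarith)
  have h0 : ρ * (1 - 2 * ρ) * θ ≤ 1 := by
    rw [mul_assoc]
    exact mul_le_one₀ (by linarith) hθρ0 hθρ1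
  refine (one_sub_pow_le_exp h0 T).trans (Real.exp_le_exp.2 ?_)
  have h1 := mul_le_mul_of_nonneg_left hT hθρ0
  have h2 : 2 + δ / 4 ≤ (1 - 2 * ρ) * θ * (2 + δ) := by
    have := mul_le_mul_of_nonneg_right hθρ (by linarith : 0 ≤ 2 + δ)
    nlinarith [mul_pos hδ hδ, mul_pos (mul_pos hδ hδ) hδ]
  have h3 := mul_le_mul_of_nonneg_left h2 hl
  have h4 : (1 - 2 * ρ) * θ * ρ ≤ 1 := mul_le_one₀ hθρ1 hρ (by linarith)
  linarith

lemma half_contraction_pow_le_exp {l δ ρ : ℝ} {T : ℕ} (hl : 0 ≤ l) (hδ : 0 < δ) (hδ1 : δ ≤ 1)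
    (hρ : 0 ≤ ρ) (hρδ : ρ ≤ δ / 16) (hT : l * δ - ρ ≤ ρ * T) :
    (1 - ρ * (1 - 2 * ρ) * (1 / 2)) ^ T ≤ Real.exp (1 - δ / 4 * l) := by
  have h0 : ρ * (1 - 2 * ρ) * (1 / 2) ≤ 1 := by nlinarith
  refine (one_sub_pow_le_exp h0 T).trans (Real.exp_le_exp.2 ?_)
  have h1 := mul_le_mul_of_nonneg_left hT (by linarith : 0 ≤ (1 - 2 * ρ) * (1 / 2))
  have h2 : (1 / 2) * (1 / 2) * (l * δ) ≤ (1 - 2 * ρ) * (1 / 2) * (l * δ) :=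
    mul_le_mul_of_nonneg_right (by linarith) (by positivity)
  have h3 : (1 - 2 * ρ) * (1 / 2) * ρ ≤ 1 := by nlinarith
  linarith

lemma one_sub_probXiLe_late_le (hn : 2 ≤ n) {δ : ℝ} (hδ : 0 < δ) (hδ1 : δ ≤ 1)
    {L : ℕ} (hL : 0 < L) (hLδ : 8 ≤ δ * (L + 1)) (hLk : 2 * L ≤ k)
    (hρδ : k * ((n : ℝ) - 1)⁻¹ ≤ δ / 16) :
    1 - probXiLe n k ⌊2 * n * Real.log k / k * (1 + δ)⌋₊
      ≤ (1 + 2 * L) * Real.exp (1 - δ / 4 * Real.log k) := by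
  have hk : 0 < k := by omega
  have hk1 : (1 : ℝ) ≤ k := by exact_mod_cast hk
  have hr := inv_sub_one_nonneg hn
  have hl : 0 ≤ Real.log k := Real.log_nonneg hk1
  have hlen := rate_mul_length hn hk
  have hN : 0 ≤ 2 * n * Real.log k / k := by positivity
  set N := 2 * n * Real.log k / k
  have hF1 := Nat.lt_floor_add_one (N * (1 + δ))
  have hF2 := Nat.lt_floor_add_one (N * (δ / 2))
  have hF3 := Nat.floor_le (mul_nonneg hN (by linarith : 0 ≤ δ / 2))
  have hle : ⌊N * (δ / 2)⌋₊ ≤ ⌊N * (1 + δ)⌋₊ := Nat.floor_mono (by nlinarith)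
  set T := ⌊N * (1 + δ)⌋₊
  set T₁ := ⌊N * (δ / 2)⌋₊
  have hmain := one_sub_probXiLe_add_le (k := k) hn (by linarith) hL (by omega) T₁ (T - T₁)
  rw [Nat.add_sub_of_le hle] at hmain
  have hT2 : ((T - T₁ : ℕ) : ℝ) = T - T₁ := Nat.cast_sub hle
  set T₂ := T - T₁
  set r := ((n : ℝ) - 1)⁻¹
  set ρ := k * r
  set l := Real.log k
  have hρ : 0 ≤ ρ := by positivity
  have hρN : 2 * l ≤ ρ * N := by
    rw [hlen]
    nlinarith [mul_nonneg hl hr]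
  have hρT1 : l * δ - ρ ≤ ρ * T₁ := by
    have h1 := mul_le_mul_of_nonneg_left hF2.le hρ
    have h2 := mul_le_mul_of_nonneg_right hρN (by linarith : 0 ≤ δ / 2)
    linarith
  have hρT2 : l * (2 + δ) - ρ ≤ ρ * T₂ := by
    have h0 : N * (1 + δ / 2) - 1 ≤ T₂ := by rw [hT2]; linarith
    have h1 := mul_le_mul_of_nonneg_left h0 hρ
    have h2 := mul_le_mul_of_nonneg_right hρN (by linarith : 0 ≤ 1 + δ / 2)
    linarith
  have hexpl : Real.exp l = k := Real.exp_log (by linarith)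
  have hL' : (1 : ℝ) ≤ L := by exact_mod_cast hL
  set θ : ℝ := (L : ℝ) / (L + 1)
  have hθ1 : θ ≤ 1 := (div_le_one (by linarith)).2 (by linarith)
  have hθ : 1 - δ / 8 ≤ θ := by
    rw [le_div_iff₀ (by linarith)]
    linarith
  have hc := contraction_pow_le_exp hl hδ hδ1 hρ hρδ hθ hθ1 hρT2
  have hd := half_contraction_pow_le_exp hl hδ hδ1 hρ hρδ hρT1
  have hd0 : 0 ≤ 1 - ρ * (1 - 2 * ρ) * (1 / 2) := by nlinarith
  have hd1 : (1 - ρ * (1 - 2 * ρ) * (1 / 2)) ^ T₁ ≤ 1 := by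
    refine pow_le_one₀ hd0 ?_
    have := mul_nonneg hρ (by linarith : 0 ≤ 1 - 2 * ρ)
    linarith
  have hkL : ((k : ℝ) / L - 1)⁻¹ * k ≤ 2 * L := by
    have h1 : (2 * L : ℝ) ≤ k := by exact_mod_cast hLk
    have h2 : 0 < (k : ℝ) / L - 1 := by
      rw [sub_pos, lt_div_iff₀ (by linarith)]
      linarith
    rw [inv_mul_le_iff₀ h2, sub_mul, div_mul_eq_mul_div, mul_left_comm, mul_div_assoc,
      mul_div_assoc, div_self (by linarith)]
    linarith
  refine hmain.trans ?_
  calc (k * (1 - ρ * (1 - 2 * ρ) * θ) ^ T₂ + ((k : ℝ) / L - 1)⁻¹)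
        * (1 - ρ * (1 - 2 * ρ) * (1 / 2)) ^ T₁ * k
      = k * k * (1 - ρ * (1 - 2 * ρ) * θ) ^ T₂ * (1 - ρ * (1 - 2 * ρ) * (1 / 2)) ^ T₁
        + ((k : ℝ) / L - 1)⁻¹ * k * (1 - ρ * (1 - 2 * ρ) * (1 / 2)) ^ T₁ := by ring
    _ ≤ k * k * Real.exp (1 - l * (2 + δ / 4)) * 1 + 2 * L * Real.exp (1 - δ / 4 * l) := by
        have := pow_nonneg hd0 T₁
        gcongr
    _ = (1 + 2 * L) * Real.exp (1 - δ / 4 * l) := by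
        rw [← hexpl, ← Real.exp_add, ← Real.exp_add]
        ring_nf

end Asymptotics

/-- **Theorem 1.1(b).**  If `k = k(n) → ∞` and `k(n)/n → 0`, then a.a.s.
`ξ(K_n, k) ~ 2 n ln k / k`: for every `ε > 0`, with probability tending to `1`,
`|ξ(K_n,k)·k/(2 n ln k) − 1| ≤ ε`. -/
theorem broadcasting_time_sublinear_k
    (k : ℕ → ℕ) (hk : Tendsto k atTop atTop)
    (hko : Tendsto (fun n => (k n : ℝ) / n) atTop (nhds 0)) :
    ∀ ε > (0:ℝ), Tendsto (fun n =>
        probXiMem n (k n) {t | |(t : ℝ) * (k n) / (2 * n * Real.log (k n)) - 1| ≤ ε})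
      atTop (nhds 1) := by
  intro ε hε
  set δ := min ε (1 / 2)
  have hδ : 0 < δ := lt_min hε (by norm_num)
  have hδε : δ ≤ ε := min_le_left _ _
  have hδ1 : δ ≤ 1 := (min_le_right _ _).trans (by norm_num)
  obtain ⟨L, hL⟩ := exists_nat_gt (8 / δ)
  have hL0 : 0 < L := by
    have : (0 : ℝ) < L := lt_trans (by positivity) hL
    exact_mod_cast this
  have hLδ : 8 ≤ δ * (L + 1) := by
    rw [div_lt_iff₀ hδ] at hL
    nlinarith
  have hlog : Tendsto (fun n => δ / 4 * Real.log (k n)) atTop atTop :=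
    (Real.tendsto_log_atTop.comp (tendsto_natCast_atTop_atTop.comp hk)).const_mul_atTop
      (by positivity)
  have hsmall : Tendsto (fun n => Real.exp (1 - δ / 4 * Real.log (k n))) atTop (nhds 0) :=
    Real.tendsto_exp_atBot.comp (tendsto_atBot_add_const_left _ 1 (tendsto_neg_atTop_atBot.comp hlog))
  have hlarge : Tendsto (fun n => Real.exp (-(Real.exp (δ / 4 * Real.log (k n) - 1) / 2)))
      atTop (nhds 0) :=
    Real.tendsto_exp_atBot.comp (tendsto_neg_atTop_atBot.comp
      ((Real.tendsto_exp_atTop.comp (tendsto_atTop_add_const_right _ (-1) hlog)).atTop_div_const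
        (by norm_num)))
  have hlow : Tendsto (fun n => 1 - (1 + 2 * L) * Real.exp (1 - δ / 4 * Real.log (k n))
      - (2 * Real.exp (1 - δ / 4 * Real.log (k n))
        + Real.exp (-(Real.exp (δ / 4 * Real.log (k n) - 1) / 2)))) atTop (nhds 1) := by
    have := ((hsmall.const_mul (1 + 2 * (L : ℝ))).const_sub 1).sub
      ((hsmall.const_mul 2).add hlarge)
    simpa using this
  have hev : ∀ᶠ n : ℕ in atTop, 2 ≤ n ∧ 2 * L ≤ k n ∧ 2 ≤ k n ∧
      (k n : ℝ) * ((n : ℝ) - 1)⁻¹ ≤ δ / 16 := by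
    filter_upwards [eventually_ge_atTop 2, hk.eventually_ge_atTop (2 * L),
      hk.eventually_ge_atTop 2, hko.eventually_le_const (by positivity : 0 < δ / 32)]
      with n hn h1 h2 h3
    refine ⟨hn, h1, h2, ?_⟩
    have hn' : (2 : ℝ) ≤ n := by exact_mod_cast hn
    rw [div_le_iff₀ (by linarith)] at h3
    rw [← div_eq_mul_inv, div_le_iff₀ (by linarith)]
    nlinarith
  have hbd : ∀ᶠ n : ℕ in atTop,
      1 - (1 + 2 * L) * Real.exp (1 - δ / 4 * Real.log (k n))
        - (2 * Real.exp (1 - δ / 4 * Real.log (k n))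
          + Real.exp (-(Real.exp (δ / 4 * Real.log (k n) - 1) / 2)))
      ≤ probXiMem n (k n) {t | |(t : ℝ) * (k n) / (2 * n * Real.log (k n)) - 1| ≤ ε} ∧
      probXiMem n (k n) {t | |(t : ℝ) * (k n) / (2 * n * Real.log (k n)) - 1| ≤ ε} ≤ 1 := by
    filter_upwards [hev] with n ⟨hn, hLk, hk2, hρ⟩
    have hk0 : 0 < k n := by omega
    have hlog0 : 0 < Real.log (k n) := Real.log_pos (by exact_mod_cast hk2)
    have hn0 : (0 : ℝ) < n := by exact_mod_cast (by omega : 0 < n)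
    have hk' : (0 : ℝ) < k n := by exact_mod_cast hk0
    have hN : 0 < 2 * n * Real.log (k n) / k n := by positivity
    have h := probXiMem_bounds hn hk0 hN hδ hδε
    simp only [div_div_eq_mul_div] at h
    have hearly := probXiLe_early_le hn hk0 hδ hδ1 hρ
    have hlate := one_sub_probXiLe_late_le hn hδ hδ1 hL0 hLδ hLk hρ
    exact ⟨by linarith [h.1], h.2⟩
  exact tendsto_of_tendsto_of_tendsto_of_le_of_le' hlow tendsto_const_nhds
    (hbd.mono fun n h => h.1) (hbd.mono fun n h => h.2)
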